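/- Let (W,S) be a Coxeter system of finite rank n ≥ 3 such that there exists m ≥ 3 with m_{st} = m for all s ≠ t ∈ S. Then for every natural number i > m one has c_{i+1} + (n-2)·d_{i-m+1} ≤ (n-1)·c_i; in particular c_{i+1} ≤ (n-1)·c_i. -/

import Mathlib

namespace CoxAux

open CoxeterSystem

variable {B : Type*} {W : Type*} [Group W] {M : CoxeterMatrix B} (cs : CoxeterSystem M W)

open Classical in
/-- The permutation of `W × ZMod 2` attached to a simple reflection. -/
noncomputable def stepFun (i : B) (p : W × ZMod 2) : W × ZMod 2 :=
  (cs.simple i * p.1 * cs.simple i, p.2 + if p.1 = cs.simple i then 1 else 0)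

open Classical in
theorem stepFun_mk (i : B) (t : W) (e : ZMod 2) : stepFun cs i (t, e) =
    (cs.simple i * t * cs.simple i, e + if t = cs.simple i then 1 else 0) := rfl

theorem stepFun_invol (i : B) (p : W × ZMod 2) : stepFun cs i (stepFun cs i p) = p := by
  obtain ⟨t, e⟩ := p
  have h2 : (1 : ZMod 2) + 1 = 0 := by decide
  have h : cs.simple i * t * cs.simple i = cs.simple i ↔ t = cs.simple i := by
    constructor
    · intro h
      have := congrArg (fun x => cs.simple i * x * cs.simple i) h
      simpa [mul_assoc] using this
    · rintro rfl
      simp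
  rw [stepFun_mk, stepFun_mk, Prod.mk.injEq]
  refine ⟨by simp [mul_assoc], ?_⟩
  by_cases ht : t = cs.simple i
  · rw [if_pos ht, if_pos (h.2 ht), add_assoc, h2, add_zero]
  · rw [if_neg ht, if_neg (fun h' => ht (h.1 h')), add_zero, add_zero]

noncomputable def stepPerm (i : B) : Equiv.Perm (W × ZMod 2) where
  toFun := stepFun cs i
  invFun := stepFun cs i
  left_inv := stepFun_invol cs i
  right_inv := stepFun_invol cs i

theorem conj_pow (i j : B) (k : ℕ) :
    ((cs.simple i * cs.simple j) ^ k)⁻¹ * cs.simple j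
      = cs.simple j * (cs.simple i * cs.simple j) ^ k := by
  induction k with
  | zero => simp
  | succ k ih =>
    rw [pow_succ' , mul_inv_rev, mul_assoc]
    have : (cs.simple i * cs.simple j)⁻¹ * cs.simple j
        = cs.simple j * (cs.simple i * cs.simple j) := by simp [mul_assoc]
    rw [this, ← mul_assoc, ih, mul_assoc]
    congr 1
    rw [← pow_succ, pow_succ']

open Classical in
theorem stepPerm_pow (i j : B) (k : ℕ) (t : W) (e : ZMod 2) :
    ((stepPerm cs i * stepPerm cs j) ^ k) (t, e) =
      ((cs.simple i * cs.simple j) ^ k * t * ((cs.simple i * cs.simple j) ^ k)⁻¹,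
        e + ∑ q ∈ Finset.range (2 * k),
          if t = cs.simple j * (cs.simple i * cs.simple j) ^ q then 1 else 0) := by
  induction k with
  | zero => simp
  | succ k ih =>
    rw [pow_succ', Equiv.Perm.mul_apply, ih]
    set c := cs.simple i * cs.simple j with hc
    have h1 : c ^ k * t * (c ^ k)⁻¹ = cs.simple j ↔ t = cs.simple j * c ^ (2 * k) := by
      rw [two_mul, pow_add, ← mul_assoc, ← conj_pow, ← hc]
      constructor
      · intro h; rw [← h]; group
      · intro h; rw [h]; group
    have h2 : cs.simple j * (c ^ k * t * (c ^ k)⁻¹) * cs.simple j = cs.simple i ↔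
        t = cs.simple j * c ^ (2 * k + 1) := by
      have : cs.simple j * c ^ (2 * k + 1) = (c ^ k)⁻¹ * (cs.simple j * c) * c ^ k := by
        rw [← mul_assoc, conj_pow, ← hc, mul_assoc, mul_assoc, ← pow_succ', ← pow_add]
        congr 2
        omega
      have hjc : cs.simple j * c = cs.simple j * cs.simple i * cs.simple j := by
        rw [hc, mul_assoc]
      rw [this, hjc]
      generalize c ^ k = g
      constructor
      · intro h
        have h' : g * t * g⁻¹ = cs.simple j * cs.simple i * cs.simple j := by
          rw [← h]; simp [mul_assoc]
        rw [← h']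
        group
      · intro h
        rw [h]
        simp [mul_assoc]
    simp only [Equiv.Perm.mul_apply, stepPerm, Equiv.coe_fn_mk, stepFun, h1, h2, Prod.mk.injEq]
    constructor
    · rw [pow_succ' c k]
      simp [hc, mul_assoc]
    · rw [show 2 * (k + 1) = 2 * k + 1 + 1 by ring, Finset.sum_range_succ, Finset.sum_range_succ]
      ring

theorem stepPerm_liftable : M.IsLiftable (stepPerm cs) := by
  classical
  intro i j
  ext1 ⟨t, e⟩
  rw [stepPerm_pow]
  have h : (cs.simple i * cs.simple j) ^ M i j = 1 := cs.simple_mul_simple_pow i j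
  rw [h, two_mul, Finset.sum_range_add]
  simp only [pow_add, h, one_mul]
  have h2 : ∀ x : ZMod 2, x + x = 0 := by decide
  rw [h2]
  simp

noncomputable def act : W →* Equiv.Perm (W × ZMod 2) := cs.lift ⟨stepPerm cs, stepPerm_liftable cs⟩

theorem act_simple (i : B) : act cs (cs.simple i) = stepPerm cs i :=
  cs.lift_apply_simple (stepPerm_liftable cs) i

theorem act_eq (w t : W) (e : ZMod 2) :
    act cs w (t, e) = (w * t * w⁻¹, e + (act cs w (t, 0)).2) := by
  induction w using cs.simple_induction_left generalizing t e with
  | one => simp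
  | mul_simple_left w i ih =>
    rw [map_mul, Equiv.Perm.mul_apply, Equiv.Perm.mul_apply, ih t e, ih t 0, act_simple]
    simp [stepPerm, stepFun, mul_assoc, add_assoc]

/-- The parity of the number of times `t` occurs among the inversions. -/
noncomputable def eta (w t : W) : ZMod 2 := (act cs w (t, 0)).2

theorem eta_mul (u v t : W) : eta cs (u * v) t = eta cs v t + eta cs u (v * t * v⁻¹) := by
  simp only [eta]
  rw [map_mul, Equiv.Perm.mul_apply, act_eq cs v t 0, act_eq]

open Classical in
theorem eta_simple (i : B) (t : W) :
    eta cs (cs.simple i) t = if t = cs.simple i then 1 else 0 := by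
  simp [eta, act_simple, stepPerm, stepFun]

theorem eta_one (t : W) : eta cs 1 t = 0 := by
  simp [eta]

theorem mem_ris_of_eta (ω : List B) (t : W) (h : eta cs (cs.wordProd ω) t ≠ 0) :
    t ∈ cs.rightInvSeq ω := by
  classical
  induction ω with
  | nil => simp [eta_one] at h
  | cons i ω ih =>
    rw [wordProd_cons, eta_mul, eta_simple] at h
    rw [rightInvSeq]
    by_cases h0 : eta cs (cs.wordProd ω) t = 0
    · rw [h0] at h
      have h1 : cs.wordProd ω * t * (cs.wordProd ω)⁻¹ = cs.simple i := by
        by_contra h1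
        simp [h1] at h
      rw [← h1]
      simp [mul_assoc]
    · exact List.mem_cons_of_mem _ (ih h0)

theorem length_lt_of_eta (w t : W) (h : eta cs w t ≠ 0) : cs.length (w * t) < cs.length w := by
  obtain ⟨ω, hω, rfl⟩ := cs.exists_isReduced w
  exact (cs.isRightInversion_of_mem_rightInvSeq hω (mem_ris_of_eta cs ω t h)).2

theorem eta_iff (w : W) (i : B) :
    cs.length (w * cs.simple i) < cs.length w ↔ eta cs w (cs.simple i) ≠ 0 := by
  refine ⟨fun h => ?_, length_lt_of_eta cs w _⟩
  have h1 : eta cs (w * cs.simple i) (cs.simple i) = 0 := by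
    by_contra h1
    have := length_lt_of_eta cs _ _ h1
    simp at this
    omega
  have h2 : w = (w * cs.simple i) * cs.simple i := by simp
  rw [h2, eta_mul, eta_simple]
  simp [h1]

/-- alternating product of length `k` ending in `y` -/
noncomputable def A (x y : B) (k : ℕ) : W := cs.wordProd (alternatingWord x y k)

theorem A_zero (x y : B) : A cs x y 0 = 1 := by simp [A, alternatingWord]

theorem A_succ (x y : B) (k : ℕ) : A cs x y (k + 1) = A cs y x k * cs.simple y := by
  rw [A, alternatingWord_succ, wordProd_concat, A]

theorem A_swap (x y : B) (k : ℕ) :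
    A cs y x k = A cs x y k * (cs.simple y * cs.simple x) ^ k := by
  induction k generalizing x y with
  | zero => simp [A_zero]
  | succ k ih =>
    rw [A_succ, ih y x, A_succ, pow_succ']
    have := conj_pow cs y x k
    have h2 : (cs.simple y * cs.simple x) ^ k * cs.simple x * (cs.simple y * cs.simple x) ^ k
      = cs.simple x := by
      rw [mul_assoc, ← this]; simp
    have h3 : (cs.simple x * cs.simple y) ^ k = ((cs.simple y * cs.simple x) ^ k)⁻¹ := by
      rw [← inv_pow]; simp
    rw [h3, mul_assoc _ _ (cs.simple x), this]
    simp [mul_assoc]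

theorem eta_A (x y : B) (k : ℕ) (t : W) (h : eta cs (A cs x y k) t ≠ 0) :
    ∃ q < k, t = cs.simple y * (cs.simple x * cs.simple y) ^ q := by
  classical
  induction k generalizing x y t with
  | zero => simp [A_zero, eta_one] at h
  | succ k ih =>
    rw [A_succ, eta_mul, eta_simple] at h
    by_cases h1 : t = cs.simple y
    · exact ⟨0, by omega, by simpa using h1⟩
    · simp only [h1, if_false, zero_add] at h
      obtain ⟨q, hq, e⟩ := ih y x _ h
      refine ⟨q + 1, by omega, ?_⟩
      have h3 : (cs.simple x * cs.simple y) ^ q = ((cs.simple y * cs.simple x) ^ q)⁻¹ := by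
        rw [← inv_pow]; simp
      have h4 := conj_pow cs y x q
      rw [← h4, ← h3, inv_simple] at e
      have : t = cs.simple y * (cs.simple y * t * cs.simple y) * cs.simple y := by
        simp [mul_assoc]
      rw [this, e, pow_succ]
      simp [mul_assoc]

theorem length_A (x y : B) (m : ℕ) (hxy : orderOf (cs.simple x * cs.simple y) = m)
    (k : ℕ) (hk : k ≤ m) : cs.length (A cs x y k) = k := by
  induction k generalizing x y with
  | zero => simp [A_zero]
  | succ k ih =>
    have hyx : orderOf (cs.simple y * cs.simple x) = m := by
      rw [← hxy, ← orderOf_inv]; simp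
    rw [A_succ]
    have hl := ih y x hyx (by omega)
    have hn : ¬ cs.length (A cs y x k * cs.simple y) < cs.length (A cs y x k) := by
      rw [eta_iff]
      intro h
      obtain ⟨q, hq, e⟩ := eta_A cs y x k _ h
      have : (cs.simple y * cs.simple x) ^ (q + 1) = 1 := by
        rw [pow_succ', mul_assoc, ← e]; simp
      have := orderOf_dvd_of_pow_eq_one this
      rw [hyx] at this
      have := Nat.le_of_dvd (by omega) this
      omega
    rcases cs.length_mul_simple (A cs y x k) y with h | h <;> omega

theorem A_comm (x y : B) (m : ℕ) (hyx : orderOf (cs.simple y * cs.simple x) = m) :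
    A cs x y m = A cs y x m := by
  rw [A_swap cs x y, ← hyx, pow_orderOf_eq_one, mul_one]

/-- The dihedral part: every element factors as minimal coset representative
times alternating product. -/
theorem exists_factor (a b : B) (m : ℕ) (hm : 1 ≤ m)
    (hab : orderOf (cs.simple a * cs.simple b) = m) (w : W) :
    ∃ u x y k, ((x = a ∧ y = b) ∨ (x = b ∧ y = a)) ∧ k ≤ m ∧ w = u * A cs x y k ∧
      ∀ x y, ((x = a ∧ y = b) ∨ (x = b ∧ y = a)) → ∀ k ≤ m,
        cs.length (u * A cs x y k) = cs.length u + k := by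
  have hba : orderOf (cs.simple b * cs.simple a) = m := by
    rw [← hab, ← orderOf_inv]; simp
  let P : Subgroup W := Subgroup.closure {cs.simple a, cs.simple b}
  have haP : cs.simple a ∈ P := Subgroup.subset_closure (by simp)
  have hbP : cs.simple b ∈ P := Subgroup.subset_closure (by simp)
  have hA : ∀ k x y, ((x = a ∧ y = b) ∨ (x = b ∧ y = a)) → A cs x y k ∈ P := by
    intro k
    induction k with
    | zero => intro x y _; rw [A_zero]; exact P.one_mem
    | succ k ih =>
      intro x y h
      rw [A_succ]
      refine P.mul_mem (ih _ _ (by tauto)) ?_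
      rcases h with ⟨rfl, rfl⟩ | ⟨rfl, rfl⟩ <;> assumption
  have hmulA : ∀ x y k z, ((x = a ∧ y = b) ∨ (x = b ∧ y = a)) → k ≤ m → (z = a ∨ z = b) →
      ∃ x' y' k', ((x' = a ∧ y' = b) ∨ (x' = b ∧ y' = a)) ∧ k' ≤ m ∧
        A cs x y k * cs.simple z = A cs x' y' k' := by
    intro x y k z hxy hk hz
    have hz' : z = x ∨ z = y := by
      rcases hxy with ⟨rfl, rfl⟩ | ⟨rfl, rfl⟩ <;> tauto
    have down : ∀ x y k, k ≤ m → 1 ≤ k → ((x = a ∧ y = b) ∨ (x = b ∧ y = a)) →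
      ∃ x' y' k', ((x' = a ∧ y' = b) ∨ (x' = b ∧ y' = a)) ∧ k' ≤ m ∧
        A cs x y k * cs.simple y = A cs x' y' k' := by
      intro x y k hk h1 hxy
      obtain ⟨k, rfl⟩ : ∃ j, k = j + 1 := ⟨k - 1, by omega⟩
      exact ⟨y, x, k, by tauto, by omega, by rw [A_succ]; simp⟩
    rcases hz' with rfl | rfl
    · by_cases hkm : k < m
      · exact ⟨y, z, k + 1, by tauto, by omega, by rw [A_succ]⟩
      · obtain rfl : k = m := by omega
        rw [A_comm cs z y k (by rcases hxy with ⟨rfl, rfl⟩ | ⟨rfl, rfl⟩ <;> assumption)]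
        exact down y z k le_rfl hm (by tauto)
    · by_cases h0 : k = 0
      · subst h0
        exact ⟨x, z, 1, hxy, hm, by rw [A_succ]; simp [A_zero]⟩
      · exact down x z k hk (by omega) hxy
  have hPA : ∀ p ∈ P, ∃ x' y' k', ((x' = a ∧ y' = b) ∨ (x' = b ∧ y' = a)) ∧ k' ≤ m ∧
        p = A cs x' y' k' := by
    intro p hp
    induction hp using Subgroup.closure_induction_right with
    | one => exact ⟨a, b, 0, by tauto, by omega, by rw [A_zero]⟩
    | mul_right p hp z hz ih =>
      obtain ⟨x, y, k, hxy, hk, rfl⟩ := ih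
      rcases hz with rfl | rfl
      · exact hmulA x y k a hxy hk (by tauto)
      · exact hmulA x y k b hxy hk (by tauto)
    | mul_inv_cancel p hp z hz ih =>
      obtain ⟨x, y, k, hxy, hk, rfl⟩ := ih
      rcases hz with rfl | rfl
      · rw [inv_simple]; exact hmulA x y k a hxy hk (by tauto)
      · rw [inv_simple]; exact hmulA x y k b hxy hk (by tauto)
  -- minimal element
  obtain ⟨p, hp, hmin⟩ : ∃ p ∈ P, ∀ q ∈ P, cs.length (w * p) ≤ cs.length (w * q) := by
    let f : P → ℕ := fun p => cs.length (w * p)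
    exact ⟨(Function.argmin f : P), (Function.argmin f).2, fun q hq => Function.argmin_le f ⟨q, hq⟩⟩
  obtain ⟨x, y, k, hxy, hk, e⟩ := hPA p⁻¹ (P.inv_mem hp)
  refine ⟨w * p, x, y, k, hxy, hk, by rw [← e]; simp, ?_⟩
  have heta : ∀ q ∈ P, eta cs (w * p) q = 0 := by
    intro q hq
    by_contra h
    have := length_lt_of_eta cs _ _ h
    have := hmin (p * q) (P.mul_mem hp hq)
    rw [← mul_assoc] at this
    omega
  intro x y hxy k
  induction k generalizing x y with
  | zero => simp [A_zero]
  | succ k ih =>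
    intro hk
    have hxy' : ((y = a ∧ x = b) ∨ (y = b ∧ x = a)) := by tauto
    have hyx : orderOf (cs.simple x * cs.simple y) = m := by
      rcases hxy with ⟨rfl, rfl⟩ | ⟨rfl, rfl⟩ <;> assumption
    have hyx' : orderOf (cs.simple y * cs.simple x) = m := by
      rcases hxy with ⟨rfl, rfl⟩ | ⟨rfl, rfl⟩ <;> assumption
    have h1 := ih y x hxy' (by omega)
    have hyP : cs.simple y ∈ P := by
      rcases hxy with ⟨rfl, rfl⟩ | ⟨rfl, rfl⟩ <;> assumption
    have hAP := hA k y x hxy'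
    rw [A_succ, ← mul_assoc]
    have hn : ¬ cs.length (w * p * A cs y x k * cs.simple y) < cs.length (w * p * A cs y x k) := by
      rw [eta_iff, eta_mul, heta _ (P.mul_mem (P.mul_mem hAP hyP) (P.inv_mem hAP)), add_zero,
        ← eta_iff, ← A_succ, length_A cs x y m hyx _ hk, length_A cs y x m hyx' k (by omega)]
      omega
    rcases cs.length_mul_simple (w * p * A cs y x k) y with h | h <;> omega

/-- If `a`, `b` are both descents then `w = u * w_{ab}`. -/
theorem two_descents (a b : B) (m : ℕ) (hm : 1 ≤ m)
    (hab : orderOf (cs.simple a * cs.simple b) = m) (w : W)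
    (ha : cs.length (w * cs.simple a) < cs.length w)
    (hb : cs.length (w * cs.simple b) < cs.length w) :
    ∃ u, w = u * A cs a b m ∧ w = u * A cs b a m ∧
      ∀ k ≤ m, cs.length (u * A cs a b k) = cs.length u + k ∧
        cs.length (u * A cs b a k) = cs.length u + k := by
  have hba : orderOf (cs.simple b * cs.simple a) = m := by
    rw [← hab, ← orderOf_inv]; simp
  obtain ⟨u, x, y, k, hxy, hk, rfl, hl⟩ := exists_factor cs a b m hm hab w
  have hx : cs.length (u * A cs x y k * cs.simple x) < cs.length (u * A cs x y k) := by
    rcases hxy with ⟨rfl, rfl⟩ | ⟨rfl, rfl⟩ <;> assumption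
  have hkm : k = m := by
    by_contra hne
    rw [mul_assoc, ← A_succ, hl y x (by tauto) (k + 1) (by omega), hl x y hxy k hk] at hx
    omega
  subst hkm
  have hc := A_comm cs a b k hba
  refine ⟨u, ?_, ?_, fun j hj => ⟨hl _ _ (by tauto) j hj, hl _ _ (by tauto) j hj⟩⟩
  · rcases hxy with ⟨rfl, rfl⟩ | ⟨rfl, rfl⟩
    · rfl
    · rw [hc]
  · rcases hxy with ⟨rfl, rfl⟩ | ⟨rfl, rfl⟩
    · rw [hc]
    · rfl

theorem no_descents (a b : B) (m : ℕ) (hm : 1 ≤ m)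
    (hab : orderOf (cs.simple a * cs.simple b) = m) (w : W)
    (ha : ¬ cs.length (w * cs.simple a) < cs.length w)
    (hb : ¬ cs.length (w * cs.simple b) < cs.length w) (k : ℕ) (hk : k ≤ m) :
    cs.length (w * A cs a b k) = cs.length w + k := by
  obtain ⟨u, x, y, j, hxy, hj, e, hl⟩ := exists_factor cs a b m hm hab w
  have hj0 : j = 0 := by
    by_contra hj0
    obtain ⟨j, rfl⟩ : ∃ i, j = i + 1 := ⟨j - 1, by omega⟩
    have hy : ¬ cs.length (w * cs.simple y) < cs.length w := by
      rcases hxy with ⟨rfl, rfl⟩ | ⟨rfl, rfl⟩ <;> assumption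
    apply hy
    have h1 := hl x y hxy (j + 1) hj
    have h2 := hl y x (by tauto) j (by omega)
    rw [← e] at h1
    have : w * cs.simple y = u * A cs y x j := by
      rw [e, A_succ]; simp [mul_assoc]
    rw [this]
    omega
  subst hj0
  rw [A_zero, mul_one] at e
  subst e
  exact hl a b (by tauto) k hk

/-- consequences of two descents -/
theorem descent_step (a b : B) (m : ℕ) (hm : 3 ≤ m)
    (hab : orderOf (cs.simple a * cs.simple b) = m) (w : W)
    (ha : cs.length (w * cs.simple a) < cs.length w)
    (hb : cs.length (w * cs.simple b) < cs.length w) :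
    cs.length (w * cs.simple b * cs.simple a) < cs.length (w * cs.simple b) ∧
    cs.length (w * cs.simple b * cs.simple a * cs.simple b)
      < cs.length (w * cs.simple b * cs.simple a) := by
  obtain ⟨u, h1, -, hl⟩ := two_descents cs a b m (by omega) hab w ha hb
  obtain ⟨m, rfl⟩ : ∃ j, m = j + 3 := ⟨m - 3, by omega⟩
  have e1 : w * cs.simple b = u * A cs b a (m + 2) := by
    rw [h1, A_succ]; simp [mul_assoc]
  have e2 : w * cs.simple b * cs.simple a = u * A cs a b (m + 1) := by
    rw [e1, A_succ]; simp [mul_assoc]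
  have e3 : w * cs.simple b * cs.simple a * cs.simple b = u * A cs b a m := by
    rw [e2, A_succ]; simp [mul_assoc]
  have l1 := (hl (m + 2) (by omega)).2
  have l2 := (hl (m + 1) (by omega)).1
  have l3 := (hl m (by omega)).2
  rw [e3, e2, e1]
  omega

theorem no_chain (m : ℕ) (hm : 3 ≤ m)
    (hM : ∀ s t : B, s ≠ t → orderOf (cs.simple s * cs.simple t) = m) (N : ℕ) :
    ∀ (w : W) (a b c : B), cs.length w = N → a ≠ b → a ≠ c → b ≠ c →
    cs.length (w * cs.simple a) < cs.length w →
    cs.length (w * cs.simple b) < cs.length w →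
    cs.length (w * cs.simple b * cs.simple c) < cs.length (w * cs.simple b) → False := by
  induction N using Nat.strong_induction_on with
  | _ N ih =>
    intro w a b c hN hab hac hbc ha hb hc
    obtain ⟨h1, h2⟩ := descent_step cs a b m hm (hM a b hab) w ha hb
    exact ih _ (hN ▸ hb) (w * cs.simple b) c a b rfl hac.symm hbc.symm hab hc h1 h2

theorem no_three (m : ℕ) (hm : 3 ≤ m)
    (hM : ∀ s t : B, s ≠ t → orderOf (cs.simple s * cs.simple t) = m)
    (w : W) (a b c : B) (hab : a ≠ b) (hac : a ≠ c) (hbc : b ≠ c)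
    (ha : cs.length (w * cs.simple a) < cs.length w)
    (hb : cs.length (w * cs.simple b) < cs.length w)
    (hc : cs.length (w * cs.simple c) < cs.length w) : False :=
  no_chain cs m hm hM _ w a b c rfl hab hac hbc ha hb
    (descent_step cs c b m hm (hM c b hbc.symm) w hc hb).1

theorem finite_length [Fintype B] (i : ℕ) : {w : W | cs.length w = i}.Finite := by
  refine ((List.finite_length_eq B i).image cs.wordProd).subset ?_
  intro w hw
  obtain ⟨ω, hω, rfl⟩ := cs.exists_isReduced w
  exact ⟨ω, hω.symm.trans hw, rfl⟩

open Classical in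
noncomputable def Des [Fintype B] (w : W) : Finset B :=
  Finset.univ.filter fun s => cs.length (w * cs.simple s) < cs.length w

theorem mem_Des [Fintype B] (w : W) (s : B) :
    s ∈ Des cs w ↔ cs.length (w * cs.simple s) < cs.length w := by simp [Des]

theorem Des_card_le [Fintype B] (m : ℕ) (hm : 3 ≤ m)
    (hM : ∀ s t : B, s ≠ t → orderOf (cs.simple s * cs.simple t) = m)
    (w : W) : (Des cs w).card ≤ 2 := by
  by_contra h
  obtain ⟨a, b, c, ha, hb, hc, hab, hac, hbc⟩ := Finset.two_lt_card_iff.1 (not_le.1 h)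
  rw [mem_Des] at ha hb hc
  exact no_three cs m hm hM w a b c hab hac hbc ha hb hc

theorem Des_card_pos [Fintype B] (w : W) (hw : cs.length w ≠ 0) : 1 ≤ (Des cs w).card := by
  have : w ≠ 1 := by rintro rfl; simp at hw
  obtain ⟨i, hi⟩ := cs.exists_rightDescent_of_ne_one this
  exact Finset.card_pos.2 ⟨i, (mem_Des cs w i).2 hi⟩

theorem Des_top [Fintype B] (m : ℕ) (hm : 3 ≤ m)
    (hM : ∀ s t : B, s ≠ t → orderOf (cs.simple s * cs.simple t) = m)
    (u : W) (a b : B) (hab : a ≠ b) (ha : a ∉ Des cs u) (hb : b ∉ Des cs u) :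
    cs.length (u * A cs a b m) = cs.length u + m ∧ a ∈ Des cs (u * A cs a b m) ∧
      b ∈ Des cs (u * A cs a b m) := by
  rw [mem_Des] at ha hb
  have h1 := no_descents cs a b m (by omega) (hM a b hab) u ha hb
  have h2 := no_descents cs b a m (by omega) (hM b a hab.symm) u hb ha
  refine ⟨h1 m le_rfl, ?_, ?_⟩
  · have l := h1 (m - 1) (by omega)
    have l2 := h2 m le_rfl
    rw [mem_Des, A_comm cs a b m (hM b a hab.symm), l2]
    have : u * A cs b a m * cs.simple a = u * A cs a b (m - 1) := by
      obtain ⟨m, rfl⟩ : ∃ j, m = j + 1 := ⟨m - 1, by omega⟩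
      rw [A_succ]; simp [mul_assoc]
    rw [this, l]
    omega
  · have l := h2 (m - 1) (by omega)
    have l2 := h1 m le_rfl
    rw [mem_Des, l2]
    have : u * A cs a b m * cs.simple b = u * A cs b a (m - 1) := by
      obtain ⟨m, rfl⟩ : ∃ j, m = j + 1 := ⟨m - 1, by omega⟩
      rw [A_succ]; simp [mul_assoc]
    rw [this, l]
    omega

/-- elements of given length -/
noncomputable def Lv [Fintype B] (i : ℕ) : Finset W := (finite_length cs i).toFinset

theorem mem_Lv [Fintype B] (i : ℕ) (w : W) : w ∈ Lv cs i ↔ cs.length w = i := by simp [Lv]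

theorem double_count [Fintype B] (i : ℕ) :
    ∑ w ∈ Lv cs (i + 1), (Des cs w).card = ∑ w ∈ Lv cs i, (Fintype.card B - (Des cs w).card) := by
  classical
  simp_rw [← Finset.card_compl]
  rw [← Finset.card_sigma, ← Finset.card_sigma]
  have key : ∀ (w : W) (s : B), cs.length w = i + 1 →
      cs.length (w * cs.simple s) < cs.length w → cs.length (w * cs.simple s) = i := by
    intro w s h1 h2
    rcases cs.length_mul_simple w s with h | h <;> omega
  refine Finset.card_bij' (fun p _ => ⟨p.1 * cs.simple p.2, p.2⟩)
    (fun p _ => ⟨p.1 * cs.simple p.2, p.2⟩) ?_ ?_ ?_ ?_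
  · rintro ⟨w, s⟩ h
    simp only [Finset.mem_sigma, mem_Lv, mem_Des, Finset.mem_compl] at h ⊢
    have := key w s h.1 h.2
    refine ⟨this, ?_⟩
    simp only [simple_mul_simple_cancel_right]
    omega
  · rintro ⟨w, s⟩ h
    simp only [Finset.mem_sigma, mem_Lv, mem_Des, Finset.mem_compl] at h ⊢
    simp only [simple_mul_simple_cancel_right]
    rcases cs.length_mul_simple w s with h' | h' <;> omega
  · rintro ⟨w, s⟩ h
    simp
  · rintro ⟨w, s⟩ h
    simp

theorem top_count [Fintype B] (hn3 : 3 ≤ Fintype.card B) (m : ℕ) (hm : 3 ≤ m)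
    (hM : ∀ s t : B, s ≠ t → orderOf (cs.simple s * cs.simple t) = m) (j : ℕ) :
    (Fintype.card B - 2) * ((Lv cs j).filter fun w => (Des cs w).card = 1).card ≤
      ((Lv cs (j + m)).filter fun w => (Des cs w).card = 2).card := by
  classical
  have hex : ∀ w : W, ∃ z : B, (Des cs w).card = 1 → z ∉ Des cs w := by
    intro w
    by_contra! h
    have h1 := (h (Classical.choice (Fintype.card_pos_iff.1 (by omega)))).1
    have : Finset.univ ⊆ Des cs w := fun z _ => (h z).2
    have := Finset.card_le_card this
    rw [Finset.card_univ] at this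
    omega
  choose z hz using hex
  have h1 : (Fintype.card B - 2) * ((Lv cs j).filter fun w => (Des cs w).card = 1).card =
      (((Lv cs j).filter fun w => (Des cs w).card = 1).sigma
        fun w => (insert (z w) (Des cs w))ᶜ).card := by
    rw [Finset.card_sigma, mul_comm, ← smul_eq_mul, ← Finset.sum_const]
    refine Finset.sum_congr rfl fun w hw => ?_
    rw [Finset.mem_filter] at hw
    rw [Finset.card_compl, Finset.card_insert_of_notMem (hz w hw.2), hw.2]
  rw [h1]
  have hD : ∀ (u : W) (t : B), (Des cs u).card = 1 → t ∉ insert (z u) (Des cs u) →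
      z u ≠ t ∧ cs.length (u * A cs (z u) t m) = cs.length u + m ∧
      Des cs (u * A cs (z u) t m) = {z u, t} := by
    intro u t hu ht
    rw [Finset.mem_insert, not_or] at ht
    have hne : z u ≠ t := fun h => ht.1 h.symm
    obtain ⟨l, da, db⟩ := Des_top cs m hm hM u (z u) t hne (hz u hu) ht.2
    refine ⟨hne, l, ?_⟩
    symm
    apply Finset.eq_of_subset_of_card_le
    · intro x hx
      simp only [Finset.mem_insert, Finset.mem_singleton] at hx
      rcases hx with rfl | rfl <;> assumption
    · rw [Finset.card_pair hne]
      exact Des_card_le cs m hm hM _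
  refine Finset.card_le_card_of_injOn (fun p => p.1 * A cs (z p.1) p.2 m) ?_ ?_
  · rintro ⟨u, t⟩ h
    simp only [Finset.coe_sigma, Set.mem_sigma_iff, Finset.mem_coe, Finset.mem_filter, mem_Lv,
      Finset.mem_compl] at h ⊢
    obtain ⟨hne, l, e⟩ := hD u t h.1.2 h.2
    rw [l, e, Finset.card_pair hne]
    exact ⟨by omega, rfl⟩
  · rintro ⟨u, t⟩ h ⟨u', t'⟩ h' heq
    simp only [Finset.coe_sigma, Set.mem_sigma_iff, Finset.mem_coe, Finset.mem_filter, mem_Lv,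
      Finset.mem_compl] at h h' heq
    obtain ⟨hne, l, e⟩ := hD u t h.1.2 h.2
    obtain ⟨hne', l', e'⟩ := hD u' t' h'.1.2 h'.2
    rw [heq, e'] at e
    have hcase : (z u = z u' ∧ t = t') ∨ (z u = t' ∧ t = z u') := by
      have a1 : z u ∈ ({z u', t'} : Finset B) := by rw [e]; simp
      have a2 : t ∈ ({z u', t'} : Finset B) := by rw [e]; simp
      simp only [Finset.mem_insert, Finset.mem_singleton] at a1 a2
      rcases a1 with a1 | a1 <;> rcases a2 with a2 | a2
      · exact absurd (a1.trans a2.symm) hne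
      · exact Or.inl ⟨a1, a2⟩
      · exact Or.inr ⟨a1, a2⟩
      · exact absurd (a1.trans a2.symm) hne
    have hu : u = u' := by
      rcases hcase with ⟨q1, q2⟩ | ⟨q1, q2⟩
      · rw [q1, q2] at heq
        exact mul_right_cancel heq
      · rw [q1, q2, A_comm cs t' (z u') m (hM _ _ hne')] at heq
        exact mul_right_cancel heq
    subst hu
    rcases hcase with ⟨q1, q2⟩ | ⟨q1, q2⟩
    · rw [q2]
    · exact absurd q2.symm hne

theorem main [Fintype B] (hn3 : 3 ≤ Fintype.card B) (m : ℕ) (hm : 3 ≤ m)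
    (hM : ∀ s t : B, s ≠ t → orderOf (cs.simple s * cs.simple t) = m)
    (i : ℕ) (hi : m < i) :
    (Lv cs (i + 1)).card +
      (Fintype.card B - 2) * ((Lv cs (i - m + 1)).filter fun w => (Des cs w).card = 1).card ≤
    (Fintype.card B - 1) * (Lv cs i).card := by
  classical
  have h1 := top_count cs hn3 m hm hM (i - m + 1)
  rw [show i - m + 1 + m = i + 1 by omega] at h1
  have h2 := double_count cs i
  have h3 : ∑ w ∈ Lv cs i, (Fintype.card B - (Des cs w).card) ≤
      (Fintype.card B - 1) * (Lv cs i).card := by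
    rw [mul_comm, ← smul_eq_mul, ← Finset.sum_const]
    refine Finset.sum_le_sum fun w hw => ?_
    rw [mem_Lv] at hw
    have := Des_card_pos cs w (by omega)
    omega
  have h4 : ∑ w ∈ Lv cs (i + 1), (Des cs w).card = (Lv cs (i + 1)).card +
      ((Lv cs (i + 1)).filter fun w => (Des cs w).card = 2).card := by
    rw [Finset.card_filter, Finset.card_eq_sum_ones, ← Finset.sum_add_distrib]
    refine Finset.sum_congr rfl fun w hw => ?_
    rw [mem_Lv] at hw
    have := Des_card_pos cs w (by omega)
    have := Des_card_le cs m hm hM w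
    split_ifs <;> omega
  omega

end CoxAux


/-- Let `(W, S)` be a Coxeter system of finite rank `n ≥ 3` such that there exists `m ≥ 3`
with `m s t = m` for all `s ≠ t` in `S`. Let `c i` be the number of elements of length `i`
and `d i` the number of elements of length `i` with exactly one right descent. Then for
every `i > m` one has `c (i+1) + (n - 2) * d (i - m + 1) ≤ (n - 1) * c i`; in particular
`c (i+1) ≤ (n - 1) * c i`. -/
theorem c_succ_add_le
    {B : Type*} [Fintype B] {W : Type*} [Group W] {M : CoxeterMatrix B}
    (cs : CoxeterSystem M W) (n : ℕ) (hn : Fintype.card B = n) (hn3 : 3 ≤ n)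
    (m : ℕ) (hm : 3 ≤ m)
    (hM : ∀ s t : B, s ≠ t → orderOf (cs.simple s * cs.simple t) = m)
    (c d : ℕ → ℕ)
    (hc : ∀ i, c i = Nat.card {w : W // cs.length w = i})
    (hd : ∀ i, d i = Nat.card {w : W // cs.length w = i ∧
      ∃! s : B, cs.length (w * cs.simple s) < cs.length w})
    (i : ℕ) (hi : m < i) :
    c (i + 1) + (n - 2) * d (i - m + 1) ≤ (n - 1) * c i ∧ c (i + 1) ≤ (n - 1) * c i := by
  classical
  subst hn
  have hci : ∀ i, c i = (CoxAux.Lv cs i).card := by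
    intro i
    rw [hc, Nat.subtype_card (CoxAux.Lv cs i) (fun w => CoxAux.mem_Lv cs i w)]
  have hdi : ∀ i, d i = ((CoxAux.Lv cs i).filter fun w => (CoxAux.Des cs w).card = 1).card := by
    intro i
    rw [hd]
    refine Nat.subtype_card _ fun w => ?_
    rw [Finset.mem_filter, CoxAux.mem_Lv, Finset.card_eq_one]
    refine and_congr_right fun _ => ?_
    constructor
    · rintro ⟨a, ha⟩
      refine ⟨a, ?_, fun b hb => ?_⟩
      · exact (CoxAux.mem_Des cs w a).1 (by rw [ha]; simp)
      · have := (CoxAux.mem_Des cs w b).2 hb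
        rw [ha] at this
        simpa using this
    · rintro ⟨a, ha, hb⟩
      refine ⟨a, ?_⟩
      ext b
      rw [CoxAux.mem_Des, Finset.mem_singleton]
      exact ⟨fun h => hb b h, fun h => h ▸ ha⟩
  have key := CoxAux.main cs hn3 m hm hM i hi
  rw [hci, hci, hdi]
  exact ⟨key, by omega⟩
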